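/- For the toroidal hexagonal lattice H^t(n,m), the energy per vertex converges as n, m → ∞ (jointly, i.e., along the product filter): lim_{n,m→∞} E(H^t(n,m))/(2nm) = (1/(4π²)) ∫₀^{2π} ∫₀^{2π} sqrt(3 + 2cos x + 2cos y + 2cos(x+y)) dx dy. -/

import Mathlib

open Real Filter SimpleGraph

/-- The adjacency matrix of a simple graph over `ℝ` is Hermitian (it is symmetric). -/
lemma adjMatrix_isHermitian {V : Type*} [Fintype V] [DecidableEq V]
    (G : SimpleGraph V) [DecidableRel G.Adj] : (G.adjMatrix ℝ).IsHermitian := by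
  unfold Matrix.IsHermitian
  rw [Matrix.conjTranspose_eq_transpose_of_trivial]
  exact G.isSymm_adjMatrix

/-- The eigenvalues (with multiplicity, indexed by the vertices) of the adjacency
matrix of a finite simple graph, regarded as a real symmetric matrix. -/
noncomputable def graphEigenvalues {V : Type*} [Fintype V] [DecidableEq V]
    (G : SimpleGraph V) : V → ℝ :=
  letI := Classical.decRel G.Adj
  (adjMatrix_isHermitian G).eigenvalues

/-- The energy of a finite simple graph: the sum of the absolute values of the
eigenvalues (with multiplicity) of its adjacency matrix. -/
noncomputable def graphEnergy {V : Type*} [Fintype V] [DecidableEq V]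
    (G : SimpleGraph V) : ℝ :=
  ∑ v, |graphEigenvalues G v|

/-- The toroidal hexagonal lattice `H^t(n,m)`: the simple graph on
`(ℤ/nℤ) × (ℤ/mℤ) × {0,1}` in which `(i,j,0)` is adjacent exactly to `(i,j,1)`,
`(i,j−1,1)` and `(i−1,j,1)`. -/
def hexTorus (n m : ℕ) : SimpleGraph (ZMod n × ZMod m × Bool) :=
  SimpleGraph.fromRel fun u v =>
    u.2.2 = false ∧ v.2.2 = true ∧
      ((v.1 = u.1 ∧ v.2.1 = u.2.1) ∨ (v.1 = u.1 ∧ v.2.1 = u.2.1 - 1) ∨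
        (v.1 = u.1 - 1 ∧ v.2.1 = u.2.1))

/-- The energy of `H^t(n,m)` as a function of `n, m` (junk value `0` when
`n = 0` or `m = 0`, where `ℤ/nℤ` is infinite). -/
noncomputable def hexTorusEnergy : ℕ → ℕ → ℝ
  | 0, _ => 0
  | _ + 1, 0 => 0
  | n + 1, m + 1 => graphEnergy (hexTorus (n + 1) (m + 1))

open ZMod (stdAddChar)

open scoped ComplexConjugate NNReal

/-- If a Hermitian matrix is diagonalized by an invertible complex matrix, then the sum of the
absolute values of its eigenvalues is read off from the diagonal. -/
lemma sum_abs_eigenvalues_eq_of_mul_eq {V : Type*} [Fintype V] [DecidableEq V]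
    {A : Matrix V V ℝ} (hA : A.IsHermitian) {P Q : Matrix V V ℂ} {d : V → ℝ}
    (hQP : Q * P = 1)
    (hAP : A.map Complex.ofReal * P = P * Matrix.diagonal fun v => (d v : ℂ)) :
    ∑ v, |hA.eigenvalues v| = ∑ v, |d v| := by
  have hPQ : P * Q = 1 := mul_eq_one_comm.mp hQP
  have hA' : A.map Complex.ofReal = P * ((Matrix.diagonal fun v => (d v : ℂ)) * Q) := by
    rw [← Matrix.mul_assoc, ← hAP, Matrix.mul_assoc, hPQ, Matrix.mul_one]
  have hchar : A.charpoly.map Complex.ofRealHom =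
      ((Matrix.diagonal d).charpoly).map Complex.ofRealHom := by
    rw [← Matrix.charpoly_map, ← Matrix.charpoly_map]
    change (A.map Complex.ofReal).charpoly = _
    rw [hA', Matrix.charpoly_mul_comm, Matrix.mul_assoc, hQP, Matrix.mul_one]
    congr 1
    ext i j
    by_cases h : i = j <;> simp [h]
  have hroots := hA.roots_charpoly_eq_eigenvalues
  rw [Polynomial.map_injective _ Complex.ofRealHom.injective hchar, Matrix.charpoly_diagonal,
    Polynomial.roots_prod _ _ (by
      simp [Finset.prod_ne_zero_iff, Polynomial.X_sub_C_ne_zero])] at hroots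
  have hmap := congrArg (fun s : Multiset ℝ => (s.map fun x => |x|).sum) hroots
  simp only [Polynomial.roots_X_sub_C, Multiset.bind_singleton, Multiset.map_map] at hmap
  exact hmap.symm

/-- The symbol of the hexagonal lattice: its modulus is the nonnegative eigenvalue of the lattice at
quasi-momentum `(x, y)`. -/
noncomputable def hexSymbol (x y : ℝ) : ℂ :=
  1 + Complex.exp (Complex.I * (-x : ℝ)) + Complex.exp (Complex.I * y)

lemma norm_hexSymbol (x y : ℝ) :
    ‖hexSymbol x y‖ = √(3 + 2 * cos x + 2 * cos y + 2 * cos (x + y)) := by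
  have hexp : ∀ t : ℝ, Complex.exp (Complex.I * t) = ⟨cos t, sin t⟩ := fun t => by
    rw [mul_comm]
    apply Complex.ext <;> simp [Complex.exp_ofReal_mul_I_re, Complex.exp_ofReal_mul_I_im]
  rw [Complex.norm_def, hexSymbol, hexp, hexp]
  congr 1
  simp only [Complex.normSq_apply, Complex.add_re, Complex.add_im, Complex.one_re, Complex.one_im,
    cos_neg, sin_neg, cos_add]
  linear_combination sin_sq_add_cos_sq x + sin_sq_add_cos_sq y

lemma norm_exp_I_mul_sub_exp_I_mul_le (x y : ℝ) :
    ‖Complex.exp (Complex.I * x) - Complex.exp (Complex.I * y)‖ ≤ |x - y| := by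
  have h : Complex.exp (Complex.I * x) - Complex.exp (Complex.I * y) =
      Complex.exp (Complex.I * y) * (Complex.exp (Complex.I * (x - y : ℝ)) - 1) := by
    rw [mul_sub, ← Complex.exp_add]
    push_cast
    ring_nf
  rw [h, norm_mul, Complex.norm_exp_I_mul_ofReal, one_mul]
  exact Real.norm_exp_I_mul_ofReal_sub_one_le

lemma lipschitzWith_norm_hexSymbol_left (y : ℝ) : LipschitzWith 1 fun x => ‖hexSymbol x y‖ := by
  refine LipschitzWith.of_dist_le_mul fun a b => ?_
  rw [Real.dist_eq, Real.dist_eq, NNReal.coe_one, one_mul]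
  refine (abs_norm_sub_norm_le _ _).trans ?_
  have h := norm_exp_I_mul_sub_exp_I_mul_le (-a) (-b)
  rw [neg_sub_neg, abs_sub_comm] at h
  simpa only [hexSymbol, add_sub_add_right_eq_sub, add_sub_add_left_eq_sub] using h

lemma lipschitzWith_norm_hexSymbol_right (x : ℝ) : LipschitzWith 1 fun y => ‖hexSymbol x y‖ := by
  refine LipschitzWith.of_dist_le_mul fun a b => ?_
  rw [Real.dist_eq, Real.dist_eq, NNReal.coe_one, one_mul]
  refine (abs_norm_sub_norm_le _ _).trans ?_
  simpa only [hexSymbol, add_sub_add_left_eq_sub] using norm_exp_I_mul_sub_exp_I_mul_le a b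

lemma stdAddChar_eq_exp {n : ℕ} [NeZero n] (k : ZMod n) :
    stdAddChar k = Complex.exp (Complex.I * (2 * π * k.val / n : ℝ)) := by
  have h := ZMod.stdAddChar_coe (N := n) (k.val : ℤ)
  rw [Int.cast_natCast, ZMod.natCast_zmod_val] at h
  rw [h]
  push_cast
  ring_nf

lemma hexSymbol_eq_stdAddChar {n m : ℕ} [NeZero n] [NeZero m] (k : ZMod n) (l : ZMod m) :
    hexSymbol (2 * π * k.val / n) (2 * π * l.val / m) =
      1 + stdAddChar (-k) + stdAddChar l := by
  rw [AddChar.map_neg_eq_conj, stdAddChar_eq_exp, stdAddChar_eq_exp, ← Complex.exp_conj, hexSymbol,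
    map_mul, Complex.conj_I, Complex.conj_ofReal, Complex.ofReal_neg, mul_neg, neg_mul]

lemma hexTorus_neighborFinset_false {n m : ℕ} [NeZero n] [NeZero m] (i : ZMod n) (j : ZMod m)
    [Fintype ((hexTorus n m).neighborSet (i, j, false))] :
    (hexTorus n m).neighborFinset (i, j, false) =
      {(i, j, true), (i, j - 1, true), (i - 1, j, true)} := by
  ext ⟨a, b, s⟩
  rw [SimpleGraph.mem_neighborFinset]
  cases s <;> simp [hexTorus]

lemma hexTorus_neighborFinset_true {n m : ℕ} [NeZero n] [NeZero m] (i : ZMod n) (j : ZMod m)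
    [Fintype ((hexTorus n m).neighborSet (i, j, true))] :
    (hexTorus n m).neighborFinset (i, j, true) =
      {(i, j, false), (i, j + 1, false), (i + 1, j, false)} := by
  ext ⟨a, b, s⟩
  rw [SimpleGraph.mem_neighborFinset]
  cases s <;> simp [hexTorus] <;> grind

/-- The unimodular phase of the symbol at the character `(k, l)`. -/
noncomputable def hexPhase {n m : ℕ} (k : ZMod n) (l : ZMod m) : ℂ :=
  Complex.exp ((hexSymbol (2 * π * k.val / n) (2 * π * l.val / m)).arg * Complex.I)

lemma norm_mul_hexPhase {n m : ℕ} (k : ZMod n) (l : ZMod m) :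
    ‖hexSymbol (2 * π * k.val / n) (2 * π * l.val / m)‖ * hexPhase k l =
      hexSymbol (2 * π * k.val / n) (2 * π * l.val / m) :=
  Complex.norm_mul_exp_arg_mul_I _

lemma conj_hexPhase_mul_hexPhase {n m : ℕ} (k : ZMod n) (l : ZMod m) :
    conj (hexPhase k l) * hexPhase k l = 1 := by
  rw [Complex.conj_mul', hexPhase, Complex.norm_exp_ofReal_mul_I]
  simp

/-- The sign attached to each of the two bands of the spectrum. -/
def bandSign (s : Bool) : ℝ := if s then 1 else -1

/-- The matrix whose columns are the Bloch eigenvectors of the toroidal hexagonal lattice. -/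
noncomputable def blochMatrix (n m : ℕ) [NeZero n] [NeZero m] :
    Matrix (ZMod n × ZMod m × Bool) (ZMod n × ZMod m × Bool) ℂ :=
  Matrix.of fun v q => stdAddChar (v.1 * q.1) * stdAddChar (-(v.2.1 * q.2.1)) *
    if v.2.2 then 1 else bandSign q.2.2 * hexPhase q.1 q.2.1

/-- The eigenvalue belonging to a column of `blochMatrix`. -/
noncomputable def blochEigenvalue (n m : ℕ) (q : ZMod n × ZMod m × Bool) : ℝ :=
  bandSign q.2.2 * ‖hexSymbol (2 * π * q.1.val / n) (2 * π * q.2.1.val / m)‖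

lemma adjMatrix_hexTorus_mul_blochMatrix {n m : ℕ} [NeZero n] [NeZero m]
    (hn : 1 < n) (hm : 1 < m) [DecidableRel (hexTorus n m).Adj] :
    ((hexTorus n m).adjMatrix ℝ).map Complex.ofReal * blochMatrix n m =
      blochMatrix n m * Matrix.diagonal fun q => (blochEigenvalue n m q : ℂ) := by
  have : Fact (1 < n) := ⟨hn⟩
  have : Fact (1 < m) := ⟨hm⟩
  have hmap : ((hexTorus n m).adjMatrix ℝ).map Complex.ofReal = (hexTorus n m).adjMatrix ℂ := by
    ext u v
    by_cases h : (hexTorus n m).Adj u v <;> simp [h]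
  rw [hmap]
  ext ⟨i, j, b⟩ ⟨k, l, s⟩
  rw [Matrix.mul_diagonal, SimpleGraph.adjMatrix_mul_apply]
  have hf := hexSymbol_eq_stdAddChar k l
  have hc := norm_mul_hexPhase k l
  have hcc := conj_hexPhase_mul_hexPhase k l
  rw [hf] at hc
  have hs : (bandSign s : ℂ) * bandSign s = 1 := by cases s <;> simp [bandSign]
  cases b
  · rw [hexTorus_neighborFinset_false, Finset.sum_insert (by simp [@eq_comm _ j, @eq_comm _ i]),
      Finset.sum_insert (by simp),
      Finset.sum_singleton]
    simp only [blochMatrix, Matrix.of_apply, blochEigenvalue, hf]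
    have h1 : stdAddChar (-((j - 1) * l)) = stdAddChar (-(j * l)) * stdAddChar l := by
      rw [← AddChar.map_add_eq_mul]; ring_nf
    have h2 : stdAddChar ((i - 1) * k) = stdAddChar (i * k) * stdAddChar (-k) := by
      rw [← AddChar.map_add_eq_mul]; ring_nf
    rw [h1, h2]
    push_cast
    linear_combination (-stdAddChar (i * k) * stdAddChar (-(j * l))) * hc -
      (stdAddChar (i * k) * stdAddChar (-(j * l)) *
        ‖1 + stdAddChar (-k) + stdAddChar l‖ * hexPhase k l) * hs
  · rw [hexTorus_neighborFinset_true, Finset.sum_insert (by simp), Finset.sum_insert (by simp),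
      Finset.sum_singleton]
    simp only [blochMatrix, Matrix.of_apply, blochEigenvalue, hf]
    have h1 : stdAddChar (-((j + 1) * l)) = stdAddChar (-(j * l)) * stdAddChar (-l) := by
      rw [← AddChar.map_add_eq_mul]; ring_nf
    have h2 : stdAddChar ((i + 1) * k) = stdAddChar (i * k) * stdAddChar k := by
      rw [← AddChar.map_add_eq_mul]; ring_nf
    have hc' := congrArg conj hc
    simp only [map_mul, map_add, map_one, Complex.conj_ofReal, ← AddChar.map_neg_eq_conj,
      neg_neg] at hc'
    rw [h1, h2]
    push_cast
    linear_combination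
      (-stdAddChar (i * k) * stdAddChar (-(j * l)) * bandSign s * hexPhase k l) * hc' +
      (stdAddChar (i * k) * stdAddChar (-(j * l)) * bandSign s *
        ‖1 + stdAddChar (-k) + stdAddChar l‖) * hcc

lemma sum_stdAddChar_conj_mul {n : ℕ} [NeZero n] (k k' : ZMod n) :
    ∑ i : ZMod n, conj (stdAddChar (i * k)) * stdAddChar (i * k') =
      if k = k' then (n : ℂ) else 0 := by
  have h := AddChar.sum_mulShift (k' - k) (ZMod.isPrimitive_stdAddChar n)
  rw [ZMod.card] at h
  simp only [sub_eq_zero, @eq_comm _ k' k] at h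
  push_cast at h
  rw [← h]
  refine Finset.sum_congr rfl fun i _ => ?_
  rw [← AddChar.map_neg_eq_conj, ← AddChar.map_add_eq_mul]
  ring_nf

lemma conjTranspose_blochMatrix_mul_self {n m : ℕ} [NeZero n] [NeZero m] :
    (blochMatrix n m).conjTranspose * blochMatrix n m = (2 * n * m : ℂ) • 1 := by
  ext ⟨k, l, s⟩ ⟨k', l', s'⟩
  have hfactor : ((blochMatrix n m).conjTranspose * blochMatrix n m) (k, l, s) (k', l', s') =
      (∑ i : ZMod n, conj (stdAddChar (i * k)) * stdAddChar (i * k')) *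
      (∑ j : ZMod m, conj (stdAddChar (j * -l)) * stdAddChar (j * -l')) *
      (1 + bandSign s * bandSign s' * (conj (hexPhase k l) * hexPhase k' l')) := by
    rw [Matrix.mul_apply, Fintype.sum_prod_type, Finset.sum_mul_sum, Finset.sum_mul]
    refine Finset.sum_congr rfl fun i _ => ?_
    rw [Fintype.sum_prod_type, Finset.sum_mul]
    refine Finset.sum_congr rfl fun j _ => ?_
    simp [blochMatrix, mul_neg]
    ring
  rw [hfactor, sum_stdAddChar_conj_mul, sum_stdAddChar_conj_mul]
  by_cases hk : k = k'
  · by_cases hl : l = l'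
    · subst hk hl
      rw [conj_hexPhase_mul_hexPhase]
      cases s <;> cases s' <;> simp [bandSign] <;> ring
    · simp [hl]
  · simp [hk]

lemma ZMod.sum_val_eq_sum_range {M : Type*} [AddCommMonoid M] (n : ℕ) [NeZero n] (f : ℕ → M) :
    ∑ k : ZMod n, f k.val = ∑ k ∈ Finset.range n, f k := by
  cases n with
  | zero => exact absurd rfl (NeZero.ne 0)
  | succ n => exact Fin.sum_univ_eq_sum_range f (n + 1)

lemma graphEnergy_hexTorus {n m : ℕ} [NeZero n] [NeZero m] (hn : 1 < n) (hm : 1 < m) :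
    graphEnergy (hexTorus n m) = 2 * ∑ k ∈ Finset.range n, ∑ l ∈ Finset.range m,
      ‖hexSymbol (2 * π * k / n) (2 * π * l / m)‖ := by
  let := Classical.decRel (hexTorus n m).Adj
  have hne : (2 * n * m : ℂ) ≠ 0 := by simp [NeZero.ne n, NeZero.ne m]
  have hQP : ((2 * n * m : ℂ)⁻¹ • (blochMatrix n m).conjTranspose) * blochMatrix n m = 1 := by
    rw [Matrix.smul_mul, conjTranspose_blochMatrix_mul_self, smul_smul, inv_mul_cancel₀ hne,
      one_smul]
  have h := sum_abs_eigenvalues_eq_of_mul_eq (adjMatrix_isHermitian (hexTorus n m)) hQP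
    (adjMatrix_hexTorus_mul_blochMatrix hn hm)
  refine Eq.trans h ?_
  rw [Fintype.sum_prod_type, Finset.mul_sum,
    ← ZMod.sum_val_eq_sum_range n fun k =>
      2 * ∑ l ∈ Finset.range m, ‖hexSymbol (2 * π * k / n) (2 * π * l / m)‖]
  refine Finset.sum_congr rfl fun k _ => ?_
  rw [Fintype.sum_prod_type, Finset.mul_sum, ← ZMod.sum_val_eq_sum_range m fun l =>
      2 * ‖hexSymbol (2 * π * k.val / n) (2 * π * l / m)‖]
  refine Finset.sum_congr rfl fun l _ => ?_
  simp [blochEigenvalue, bandSign, two_mul]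

/-- Error bound for left Riemann sums of Lipschitz functions. -/
lemma abs_riemannSum_sub_integral_le {f : ℝ → ℝ} {K : ℝ≥0} (hf : LipschitzWith K f) {T : ℝ}
    (hT : 0 ≤ T) {n : ℕ} (hn : n ≠ 0) :
    |T / n * ∑ k ∈ Finset.range n, f (T * k / n) - ∫ x in (0 : ℝ)..T, f x| ≤ K * T ^ 2 / n := by
  have hn' : (n : ℝ) ≠ 0 := Nat.cast_ne_zero.mpr hn
  have hstep : ∀ k : ℕ, T * (k + 1 : ℕ) / n - T * k / n = T / n := fun k => by
    push_cast; ring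
  have hTn : 0 ≤ T / n := by positivity
  have hint : ∫ x in (0 : ℝ)..T, f x =
      ∑ k ∈ Finset.range n, ∫ x in (T * k / n)..(T * (k + 1 : ℕ) / n), f x := by
    rw [intervalIntegral.sum_integral_adjacent_intervals (a := fun k : ℕ => T * k / n)
      fun k _ => hf.continuous.intervalIntegrable _ _]
    simp [hn']
  rw [hint, Finset.mul_sum, ← Finset.sum_sub_distrib]
  have hcell : ∀ k ∈ Finset.range n,
      |T / n * f (T * k / n) - ∫ x in (T * k / n)..(T * (k + 1 : ℕ) / n), f x| ≤
        K * (T / n) * (T / n) := fun k _ => by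
    have hconst : T / n * f (T * k / n) =
        ∫ _ in (T * k / n)..(T * (k + 1 : ℕ) / n), f (T * k / n) := by
      rw [intervalIntegral.integral_const, hstep, smul_eq_mul]
    rw [hconst, ← intervalIntegral.integral_sub (by simp)
      (hf.continuous.intervalIntegrable _ _), ← Real.norm_eq_abs]
    refine (intervalIntegral.norm_integral_le_of_norm_le_const
      (C := K * (T / n)) fun x hx => ?_).trans_eq ?_
    · rw [Set.uIoc_of_le (by linarith [hstep k])] at hx
      have h := hf.dist_le_mul (T * k / n) x
      rw [Real.dist_eq, Real.dist_eq] at h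
      refine h.trans (mul_le_mul_of_nonneg_left ?_ K.coe_nonneg)
      rw [abs_le]
      constructor <;> linarith [hstep k, hx.1, hx.2]
    · rw [hstep, abs_of_nonneg hTn]
  refine (Finset.abs_sum_le_sum_abs _ _).trans ((Finset.sum_le_sum hcell).trans_eq ?_)
  rw [Finset.sum_const, Finset.card_range, nsmul_eq_mul]
  field_simp

lemma lipschitzWith_intervalIntegral {F : ℝ → ℝ → ℝ} {K : ℝ≥0}
    (hleft : ∀ y, LipschitzWith K fun x => F x y) (hright : ∀ x, Continuous (F x)) (T : ℝ≥0) :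
    LipschitzWith (K * T) fun x => ∫ y in (0 : ℝ)..T, F x y := by
  refine LipschitzWith.of_dist_le_mul fun a b => ?_
  rw [Real.dist_eq, ← intervalIntegral.integral_sub ((hright a).intervalIntegrable _ _)
    ((hright b).intervalIntegrable _ _), ← Real.norm_eq_abs]
  refine (intervalIntegral.norm_integral_le_of_norm_le_const
    (C := K * dist a b) fun y _ => (hleft y).dist_le_mul a b).trans_eq ?_
  simp only [sub_zero, NNReal.abs_eq, NNReal.coe_mul]
  ring

/-- Error bound for Riemann sums over a square grid of separately Lipschitz functions. -/
lemma abs_riemannSum_sub_integral_integral_le {F : ℝ → ℝ → ℝ} {K : ℝ≥0}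
    (hleft : ∀ y, LipschitzWith K fun x => F x y) (hright : ∀ x, LipschitzWith K (F x))
    (T : ℝ≥0) {n m : ℕ} (hn : n ≠ 0) (hm : m ≠ 0) :
    |(T : ℝ) / n * (T / m) * ∑ k ∈ Finset.range n, ∑ l ∈ Finset.range m, F (T * k / n) (T * l / m) -
      ∫ x in (0 : ℝ)..T, ∫ y in (0 : ℝ)..T, F x y| ≤ K * T ^ 3 * (1 / m + 1 / n) := by
  have hn' : (n : ℝ) ≠ 0 := Nat.cast_ne_zero.mpr hn
  set G : ℝ → ℝ := fun x => ∫ y in (0 : ℝ)..T, F x y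
  have houter := abs_riemannSum_sub_integral_le
    (lipschitzWith_intervalIntegral hleft (fun x => (hright x).continuous) T) T.coe_nonneg hn
  have hinner : |(T : ℝ) / n * ∑ k ∈ Finset.range n,
      (T / m * ∑ l ∈ Finset.range m, F (T * k / n) (T * l / m) - G (T * k / n))| ≤
      T / n * (n * (K * T ^ 2 / m)) := by
    rw [abs_mul, abs_of_nonneg (by positivity : (0 : ℝ) ≤ T / n)]
    refine mul_le_mul_of_nonneg_left ?_ (by positivity)
    refine (Finset.abs_sum_le_sum_abs _ _).trans ((Finset.sum_le_sum fun k _ =>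
      abs_riemannSum_sub_integral_le (hright _) T.coe_nonneg hm).trans_eq ?_)
    rw [Finset.sum_const, Finset.card_range, nsmul_eq_mul]
  have hsplit : (T : ℝ) / n * (T / m) *
        ∑ k ∈ Finset.range n, ∑ l ∈ Finset.range m, F (T * k / n) (T * l / m) -
        ∫ x in (0 : ℝ)..T, G x =
      (T : ℝ) / n * ∑ k ∈ Finset.range n,
        (T / m * ∑ l ∈ Finset.range m, F (T * k / n) (T * l / m) - G (T * k / n)) +
      (T / n * ∑ k ∈ Finset.range n, G (T * k / n) - ∫ x in (0 : ℝ)..T, G x) := by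
    rw [Finset.sum_sub_distrib, ← Finset.mul_sum]
    ring
  rw [hsplit]
  refine (abs_add_le _ _).trans ((add_le_add hinner houter).trans_eq ?_)
  push_cast
  field_simp

lemma tendsto_riemannSum_integral_integral {F : ℝ → ℝ → ℝ} {K : ℝ≥0}
    (hleft : ∀ y, LipschitzWith K fun x => F x y) (hright : ∀ x, LipschitzWith K (F x))
    {T : ℝ} (hT : 0 ≤ T) :
    Tendsto (fun p : ℕ × ℕ => T / p.1 * (T / p.2) *
        ∑ k ∈ Finset.range p.1, ∑ l ∈ Finset.range p.2, F (T * k / p.1) (T * l / p.2))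
      (atTop ×ˢ atTop) (nhds (∫ x in (0 : ℝ)..T, ∫ y in (0 : ℝ)..T, F x y)) := by
  lift T to ℝ≥0 using hT
  rw [tendsto_iff_dist_tendsto_zero]
  have hbound : Tendsto (fun p : ℕ × ℕ => (K * T ^ 3 * (1 / p.2 + 1 / p.1) : ℝ))
      (atTop ×ˢ atTop) (nhds 0) := by
    have h := ((tendsto_one_div_atTop_nhds_zero_nat (𝕜 := ℝ)).comp
      (tendsto_snd (f := (atTop : Filter ℕ)))).add
      ((tendsto_one_div_atTop_nhds_zero_nat (𝕜 := ℝ)).comp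
      (tendsto_fst (g := (atTop : Filter ℕ))))
    simpa using h.const_mul (K * T ^ 3 : ℝ)
  refine squeeze_zero' (Eventually.of_forall fun _ => dist_nonneg) ?_ hbound
  filter_upwards [(eventually_ne_atTop 0).prod_mk (eventually_ne_atTop 0)] with p hp
  exact abs_riemannSum_sub_integral_integral_le hleft hright T hp.1 hp.2

lemma hexTorusEnergy_eq {n m : ℕ} (hn : 1 < n) (hm : 1 < m) :
    hexTorusEnergy n m = 2 * ∑ k ∈ Finset.range n, ∑ l ∈ Finset.range m,
      ‖hexSymbol (2 * π * k / n) (2 * π * l / m)‖ := by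
  obtain ⟨n, rfl⟩ := Nat.exists_eq_succ_of_ne_zero (by omega : n ≠ 0)
  obtain ⟨m, rfl⟩ := Nat.exists_eq_succ_of_ne_zero (by omega : m ≠ 0)
  exact graphEnergy_hexTorus hn hm

/-- the energy per vertex of the toroidal hexagonal lattice converges,
as `n, m → ∞` jointly, to
`(1/(4π²)) ∫₀^{2π} ∫₀^{2π} sqrt(3 + 2cos x + 2cos y + 2cos(x+y)) dx dy`. -/
theorem energy_per_vertex_hexTorus :
    Tendsto (fun p : ℕ × ℕ => hexTorusEnergy p.1 p.2 / (2 * (p.1 : ℝ) * (p.2 : ℝ)))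
      (atTop ×ˢ atTop)
      (nhds ((1 / (4 * π ^ 2)) *
        ∫ x in (0:ℝ)..2 * π, ∫ y in (0:ℝ)..2 * π,
          Real.sqrt (3 + 2 * Real.cos x + 2 * Real.cos y + 2 * Real.cos (x + y)))) := by
  simp_rw [← norm_hexSymbol]
  have h := (tendsto_riemannSum_integral_integral lipschitzWith_norm_hexSymbol_left
    lipschitzWith_norm_hexSymbol_right two_pi_pos.le).const_mul (1 / (4 * π ^ 2))
  refine h.congr' ?_
  filter_upwards [(eventually_gt_atTop 1).prod_mk (eventually_gt_atTop 1)] with p hp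
  have h1 : (p.1 : ℝ) ≠ 0 := Nat.cast_ne_zero.mpr (by omega)
  have h2 : (p.2 : ℝ) ≠ 0 := Nat.cast_ne_zero.mpr (by omega)
  rw [hexTorusEnergy_eq hp.1 hp.2]
  field_simp
  ring
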